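/- Let C, C̃ > 4/3^{3/2} and let Θ: D_C → D_{C̃} be an isometry between (D_C, g_C) and (D_{C̃}, g_{C̃}), where g_C = 3/(ξ²(−ξ^{8/3}+3Cξ²−3)) dξ² + (1/ξ²) dθ². Then C = C̃ and Θ(ξ,θ) = (ξ, ±θ + a₁) for some constant a₁ ∈ ℝ. -/

import Mathlib

open Real Set

def HD (F : ℝ × ℝ → ℝ) (a b : ℝ) (p : ℝ × ℝ) : Prop :=
  HasFDerivAt F (a • ContinuousLinearMap.fst ℝ ℝ ℝ + b • ContinuousLinearMap.snd ℝ ℝ ℝ) p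

lemma HD.of_diff {F : ℝ × ℝ → ℝ} {p : ℝ × ℝ} (h : DifferentiableAt ℝ F p) :
    HD F (fderiv ℝ F p (1, 0)) (fderiv ℝ F p (0, 1)) p := by
  unfold HD
  convert h.hasFDerivAt using 1
  ext <;> simp

lemma HD.congr_val {F : ℝ × ℝ → ℝ} {a b a' b' : ℝ} {p : ℝ × ℝ} (h : HD F a b p)
    (ha : a = a') (hb : b = b') : HD F a' b' p := by subst ha hb; exact h

lemma HD.diff {F : ℝ × ℝ → ℝ} {a b : ℝ} {p : ℝ × ℝ} (h : HD F a b p) :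
    DifferentiableAt ℝ F p := HasFDerivAt.differentiableAt h

lemma HD.unique {F : ℝ × ℝ → ℝ} {a b a' b' : ℝ} {p : ℝ × ℝ} (h : HD F a b p)
    (h' : HD F a' b' p) : a = a' ∧ b = b' := by
  have := HasFDerivAt.unique h h'
  have h1 := congrArg (fun L => L (1, 0)) this
  have h2 := congrArg (fun L => L (0, 1)) this
  simpa using And.intro h1 h2

lemma HD.mul {F H : ℝ × ℝ → ℝ} {a b c d : ℝ} {p : ℝ × ℝ} (h : HD F a b p) (h' : HD H c d p) :
    HD (fun q => F q * H q) (a * H p + F p * c) (b * H p + F p * d) p := by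
  unfold HD at *
  refine HasFDerivAt.congr_fderiv (HasFDerivAt.fun_mul h h') ?_
  ext <;> simp <;> ring

lemma HD.add {F H : ℝ × ℝ → ℝ} {a b c d : ℝ} {p : ℝ × ℝ} (h : HD F a b p) (h' : HD H c d p) :
    HD (fun q => F q + H q) (a + c) (b + d) p := by
  unfold HD at *
  refine HasFDerivAt.congr_fderiv (HasFDerivAt.fun_add h h') ?_
  ext <;> simp

lemma HD.sub {F H : ℝ × ℝ → ℝ} {a b c d : ℝ} {p : ℝ × ℝ} (h : HD F a b p) (h' : HD H c d p) :
    HD (fun q => F q - H q) (a - c) (b - d) p := by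
  unfold HD at *
  refine HasFDerivAt.congr_fderiv (HasFDerivAt.fun_sub h h') ?_
  ext <;> simp

lemma HD.const (k : ℝ) (p : ℝ × ℝ) : HD (fun _ => k) 0 0 p := by
  unfold HD
  refine HasFDerivAt.congr_fderiv (hasFDerivAt_const k p) ?_
  ext <;> simp

lemma HD.fst (p : ℝ × ℝ) : HD (fun q => q.1) 1 0 p := by
  unfold HD
  refine HasFDerivAt.congr_fderiv (hasFDerivAt_fst (𝕜 := ℝ) (p := p)) ?_
  ext <;> simp

lemma HD.comp {F : ℝ × ℝ → ℝ} {a b : ℝ} {p : ℝ × ℝ} {g : ℝ → ℝ} {g' : ℝ}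
    (hg : HasDerivAt g g' (F p)) (h : HD F a b p) :
    HD (fun q => g (F q)) (g' * a) (g' * b) p := by
  unfold HD at *
  refine HasFDerivAt.congr_fderiv (HasDerivAt.comp_hasFDerivAt p hg h) ?_
  ext <;> simp

lemma HD.inv {F : ℝ × ℝ → ℝ} {a b : ℝ} {p : ℝ × ℝ} (h : HD F a b p) (h0 : F p ≠ 0) :
    HD (fun q => (F q)⁻¹) (-(F p ^ 2)⁻¹ * a) (-(F p ^ 2)⁻¹ * b) p :=
  HD.comp (hasDerivAt_inv h0) h

lemma HD.symm {F P Q : ℝ × ℝ → ℝ} {p : ℝ × ℝ} {P1 P2 Q1 Q2 : ℝ}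
    (hF : ∀ᶠ q in nhds p, HD F (P q) (Q q) q) (hP : HD P P1 P2 p) (hQ : HD Q Q1 Q2 p) :
    P2 = Q1 := by
  unfold HD at *
  have h1 := (HasFDerivAt.smul_const hP (ContinuousLinearMap.fst ℝ ℝ ℝ)).add
    (HasFDerivAt.smul_const hQ (ContinuousLinearMap.snd ℝ ℝ ℝ))
  have := second_derivative_symmetric_of_eventually hF h1 (0, 1) (1, 0)
  simpa using this

lemma HD.congr_ev {F H : ℝ × ℝ → ℝ} {a b : ℝ} {p : ℝ × ℝ} (h : HD F a b p)
    (e : ∀ᶠ q in nhds p, H q = F q) : HD H a b p :=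
  HasFDerivAt.congr_of_eventuallyEq h e
  
/-- Step 1: connection form. -/
lemma step1 {A A1 B P At At1 Bt Pt : ℝ → ℝ} {ε : ℝ} (hε : ε ^ 2 = 1)
    {u v c s : ℝ × ℝ → ℝ} {p : ℝ × ℝ}
    (hA : HasDerivAt A (A1 p.1) p.1) (hB : HasDerivAt B (P p.1 * A p.1) p.1)
    (hAt : HasDerivAt At (At1 (u p)) (u p)) (hBt : HasDerivAt Bt (Pt (u p) * At (u p)) (u p))
    (pA : 0 < A p.1) (pB : 0 < B p.1) (pAt : 0 < At (u p)) (pBt : 0 < Bt (u p))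
    (hcs : ∀ᶠ q in nhds p, c q * c q + s q * s q = 1)
    (hu : ∀ᶠ q in nhds p, HD u (A q.1 * c q * (At (u q))⁻¹) (-ε * B q.1 * s q * (At (u q))⁻¹) q)
    (hv : ∀ᶠ q in nhds p, HD v (A q.1 * s q * (Bt (u q))⁻¹) (ε * B q.1 * c q * (Bt (u q))⁻¹) q)
    (hc : DifferentiableAt ℝ c p) (hs : DifferentiableAt ℝ s p) :
    HD c (s p * (Pt (u p) * (A p.1 * s p * (Bt (u p))⁻¹)))
      (-s p * (ε * P p.1 - Pt (u p) * (ε * B p.1 * c p * (Bt (u p))⁻¹))) p ∧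
    HD s (-c p * (Pt (u p) * (A p.1 * s p * (Bt (u p))⁻¹)))
      (c p * (ε * P p.1 - Pt (u p) * (ε * B p.1 * c p * (Bt (u p))⁻¹))) p := by
  have hc := HD.of_diff hc
  have hs := HD.of_diff hs
  set cx := fderiv ℝ c p (1, 0)
  set cy := fderiv ℝ c p (0, 1)
  set sx := fderiv ℝ s p (1, 0)
  set sy := fderiv ℝ s p (0, 1)
  have hup := hu.self_of_nhds
  have dA := HD.comp hA (HD.fst p)
  have dB := HD.comp hB (HD.fst p)
  have dAt := HD.inv (HD.comp hAt hup) pAt.ne'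
  have dBt := HD.inv (HD.comp hBt hup) pBt.ne'
  have e0 := HD.unique (((hc.mul hc).add (hs.mul hs)).congr_ev (hcs.mono fun q h => h.symm))
    (HD.const 1 p)
  have e1 := HD.symm hu ((dA.mul hc).mul dAt) ((((HD.const (-ε) p).mul dB).mul hs).mul dAt)
  have e2 := HD.symm hv ((dA.mul hs).mul dBt) ((((HD.const ε p).mul dB).mul hc).mul dBt)
  have e3 := hcs.self_of_nhds
  obtain ⟨e0, e0'⟩ := e0
  generalize A p.1 = A at *
  generalize B p.1 = B at *
  generalize A1 p.1 = A1 at *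
  generalize P p.1 = P at *
  generalize At (u p) = At at *
  generalize Bt (u p) = Bt at *
  generalize At1 (u p) = At1 at *
  generalize Pt (u p) = Pt at *
  generalize c p = c0 at *
  generalize s p = s0 at *
  clear_value cx cy sx sy
  have e1' : A * cy = -ε * (P * A * s0 + B * sx) := by
    field_simp at e1
    have : At ^ 2 ≠ 0 := by positivity
    apply mul_left_cancel₀ this
    linear_combination e1
  have e2' : A * sy * Bt + ε * A * B * Pt = ε * (P * A * c0 + B * cx) * Bt := by
    field_simp at e2
    have e2 : (A * sy) * Bt + A * Pt * ε * B * s0 ^ 2 = ε * (P * A * c0 + B * cx) * Bt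
      - ε * A * B * c0 ^ 2 * Pt := by linear_combination e2
    linear_combination e2 - ε * A * B * Pt * e3
  have ay : c0 * sy - s0 * cy = ε * P - Pt * (ε * B * c0 * Bt⁻¹) := by
    field_simp
    apply mul_left_cancel₀ pA.ne'
    linear_combination c0 * e2' - s0 * Bt * e1' + ε * P * A * Bt * e3 + ε * B * Bt / 2 * e0
  have ax : c0 * sx - s0 * cx = -(Pt * (A * s0 * Bt⁻¹)) := by
    have hε0 : ε ≠ 0 := by rintro rfl; norm_num at hε
    field_simp
    apply mul_left_cancel₀ (mul_ne_zero hε0 pB.ne')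
    linear_combination s0 * e2' + c0 * Bt * e1' - A * Bt / 2 * e0'
  constructor
  · refine hc.congr_val ?_ ?_
    · linear_combination (-s0) * ax - cx * e3 + c0 / 2 * e0
    · linear_combination (-s0) * ay - cy * e3 + c0 / 2 * e0'
  · refine hs.congr_val ?_ ?_
    · linear_combination (c0) * ax - sx * e3 + s0 / 2 * e0
    · linear_combination (c0) * ay - sy * e3 + s0 / 2 * e0'

lemma step2 {P P1 Pt Pt1 : ℝ → ℝ} {ε : ℝ}
    {u v c s ux uy vx vy : ℝ × ℝ → ℝ} {p : ℝ × ℝ}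
    (hP : HasDerivAt P (P1 p.1) p.1) (hPt : HasDerivAt Pt (Pt1 (u p)) (u p))
    (hcs : c p * c p + s p * s p = 1)
    (hu : HD u (ux p) (uy p) p)
    (hv : ∀ᶠ q in nhds p, HD v (vx q) (vy q) q)
    (hvx : DifferentiableAt ℝ vx p) (hvy : DifferentiableAt ℝ vy p)
    (hc : ∀ᶠ q in nhds p, HD c (s q * (Pt (u q) * vx q)) (-1 * s q * (ε * P q.1 - Pt (u q) * vy q)) q)
    (hs : ∀ᶠ q in nhds p, HD s (-1 * c q * (Pt (u q) * vx q)) (c q * (ε * P q.1 - Pt (u q) * vy q)) q) :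
    ε * P1 p.1 = Pt1 (u p) * (ux p * vy p - uy p * vx p) := by
  have dvx := HD.of_diff hvx
  have dvy := HD.of_diff hvy
  have e0 := HD.symm hv dvx dvy
  have dP := (HD.const ε p).mul (HD.comp hP (HD.fst p))
  have dPt := HD.comp hPt hu
  have dc := hc.self_of_nhds
  have ds := hs.self_of_nhds
  have e1 := HD.symm hc (ds.mul (dPt.mul dvx)) (((HD.const (-1) p).mul ds).mul (dP.sub (dPt.mul dvy)))
  have e2 := HD.symm hs (((HD.const (-1) p).mul dc).mul (dPt.mul dvx)) (dc.mul (dP.sub (dPt.mul dvy)))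
  rw [e0] at e1 e2
  linear_combination s p * e1 - c p * e2 - 
    (ε * P1 p.1 - Pt1 (u p) * (ux p * vy p - uy p * vx p)) * hcs

lemma egregium {A A1 B P P1 At At1 Bt Pt Pt1 : ℝ → ℝ} {Ω : Set (ℝ × ℝ)} (hΩ : IsOpen Ω)
    {u v : ℝ × ℝ → ℝ} (hu : ContDiffOn ℝ 2 u Ω) (hv : ContDiffOn ℝ 2 v Ω)
    (hA : ∀ p ∈ Ω, HasDerivAt A (A1 p.1) p.1) (hB : ∀ p ∈ Ω, HasDerivAt B (P p.1 * A p.1) p.1)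
    (hP : ∀ p ∈ Ω, HasDerivAt P (P1 p.1) p.1)
    (hAt : ∀ p ∈ Ω, HasDerivAt At (At1 (u p)) (u p))
    (hBt : ∀ p ∈ Ω, HasDerivAt Bt (Pt (u p) * At (u p)) (u p))
    (hPt : ∀ p ∈ Ω, HasDerivAt Pt (Pt1 (u p)) (u p))
    (pA : ∀ p ∈ Ω, 0 < A p.1) (pB : ∀ p ∈ Ω, 0 < B p.1)
    (pAt : ∀ p ∈ Ω, 0 < At (u p)) (pBt : ∀ p ∈ Ω, 0 < Bt (u p))
    (h1 : ∀ p ∈ Ω, (At (u p) * fderiv ℝ u p (1, 0)) ^ 2 + (Bt (u p) * fderiv ℝ v p (1, 0)) ^ 2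
      = A p.1 ^ 2)
    (h2 : ∀ p ∈ Ω, (At (u p) * fderiv ℝ u p (1, 0)) * (At (u p) * fderiv ℝ u p (0, 1))
      + (Bt (u p) * fderiv ℝ v p (1, 0)) * (Bt (u p) * fderiv ℝ v p (0, 1)) = 0)
    (h3 : ∀ p ∈ Ω, (At (u p) * fderiv ℝ u p (0, 1)) ^ 2 + (Bt (u p) * fderiv ℝ v p (0, 1)) ^ 2
      = B p.1 ^ 2) :
    ∀ p ∈ Ω, P1 p.1 * (At (u p) * Bt (u p)) = Pt1 (u p) * (A p.1 * B p.1) := by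
  intro p hp
  have key : ∀ {w : ℝ × ℝ → ℝ}, ContDiffOn ℝ 2 w Ω → ∀ q ∈ Ω, DifferentiableAt ℝ w q ∧
      ∀ e, DifferentiableAt ℝ (fun q => fderiv ℝ w q e) q := by
    intro w hw q hq
    refine ⟨(hw.differentiableOn (by norm_num)).differentiableAt (hΩ.mem_nhds hq), fun e => ?_⟩
    have := (hw.fderiv_of_isOpen (m := 1) hΩ (by norm_num)).differentiableOn (by norm_num)
    exact (this.differentiableAt (hΩ.mem_nhds hq)).clm_apply (differentiableAt_const e)
  set ux := fun q => fderiv ℝ u q (1, 0) with hux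
  set uy := fun q => fderiv ℝ u q (0, 1) with huy
  set vx := fun q => fderiv ℝ v q (1, 0) with hvx
  set vy := fun q => fderiv ℝ v q (0, 1) with hvy
  have du : ∀ q ∈ Ω, HD u (ux q) (uy q) q := fun q hq => HD.of_diff (key hu q hq).1
  have dv : ∀ q ∈ Ω, HD v (vx q) (vy q) q := fun q hq => HD.of_diff (key hv q hq).1
  have dux : ∀ q ∈ Ω, DifferentiableAt ℝ ux q := fun q hq => (key hu q hq).2 _
  have duy : ∀ q ∈ Ω, DifferentiableAt ℝ uy q := fun q hq => (key hu q hq).2 _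
  have dvx : ∀ q ∈ Ω, DifferentiableAt ℝ vx q := fun q hq => (key hv q hq).2 _
  have dvy : ∀ q ∈ Ω, DifferentiableAt ℝ vy q := fun q hq => (key hv q hq).2 _
  have dA : ∀ q ∈ Ω, DifferentiableAt ℝ (fun q => (A q.1)⁻¹) q := fun q hq =>
    (HD.inv (HD.comp (hA q hq) (HD.fst q)) (pA q hq).ne').diff
  have dB : ∀ q ∈ Ω, DifferentiableAt ℝ (fun q => (B q.1)⁻¹) q := fun q hq =>
    (HD.inv (HD.comp (hB q hq) (HD.fst q)) (pB q hq).ne').diff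
  have dAt : ∀ q ∈ Ω, DifferentiableAt ℝ (fun q => At (u q)) q := fun q hq =>
    (HD.comp (hAt q hq) (du q hq)).diff
  have dBt : ∀ q ∈ Ω, DifferentiableAt ℝ (fun q => Bt (u q)) q := fun q hq =>
    (HD.comp (hBt q hq) (du q hq)).diff
  set c := fun q => At (u q) * ux q * (A q.1)⁻¹ with hc
  set s := fun q => Bt (u q) * vx q * (A q.1)⁻¹ with hs
  set e := fun q => (At (u q) * ux q * (Bt (u q) * vy q) - At (u q) * uy q * (Bt (u q) * vx q))
    * (A q.1)⁻¹ * (B q.1)⁻¹ with he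
  have dc : ∀ q ∈ Ω, DifferentiableAt ℝ c q := fun q hq =>
    ((dAt q hq).fun_mul (dux q hq)).fun_mul (dA q hq)
  have ds : ∀ q ∈ Ω, DifferentiableAt ℝ s q := fun q hq =>
    ((dBt q hq).fun_mul (dvx q hq)).fun_mul (dA q hq)
  have de : ContinuousAt e p := by
    refine DifferentiableAt.continuousAt (𝕜 := ℝ) ?_
    exact (((((dAt p hp).fun_mul (dux p hp)).fun_mul ((dBt p hp).fun_mul (dvy p hp))).fun_sub
      (((dAt p hp).fun_mul (duy p hp)).fun_mul ((dBt p hp).fun_mul (dvx p hp)))).fun_mul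
        (dA p hp)).fun_mul (dB p hp)
  have alg : ∀ q ∈ Ω, c q * c q + s q * s q = 1 ∧ e q ^ 2 = 1 ∧ ux q = A q.1 * c q * (At (u q))⁻¹ ∧
      uy q = -e q * B q.1 * s q * (At (u q))⁻¹ ∧ vx q = A q.1 * s q * (Bt (u q))⁻¹ ∧
      vy q = e q * B q.1 * c q * (Bt (u q))⁻¹ := by
    intro q hq
    have a1 := h1 q hq
    have a2 := h2 q hq
    have a3 := h3 q hq
    have b1 := pA q hq
    have b2 := pB q hq
    have b3 := pAt q hq
    have b4 := pBt q hq
    change (At (u q) * ux q) ^ 2 + (Bt (u q) * vx q) ^ 2 = _ at a1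
    change (At (u q) * ux q) * (At (u q) * uy q) + (Bt (u q) * vx q) * (Bt (u q) * vy q) = _ at a2
    change (At (u q) * uy q) ^ 2 + (Bt (u q) * vy q) ^ 2 = _ at a3
    simp only [hc, hs, he]
    generalize A q.1 = A at *
    generalize B q.1 = B at *
    generalize At (u q) = At at *
    generalize Bt (u q) = Bt at *
    generalize ux q = x1 at *
    generalize uy q = x2 at *
    generalize vx q = y1 at *
    generalize vy q = y2 at *
    refine ⟨?_, ?_, ?_, ?_, ?_, ?_⟩
    · field_simp
      linear_combination a1
    · field_simp
      linear_combination B ^ 2 * a1 + ((At * x1) ^ 2 + (Bt * y1) ^ 2) * a3 -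
        (At * x1 * (At * x2) + (Bt * y1) * (Bt * y2)) * a2
    · field_simp
    · field_simp
      linear_combination (-x2) * a1 + x1 * a2
    · field_simp
    · field_simp
      linear_combination (-y2) * a1 + y1 * a2
  have evΩ : ∀ᶠ q in nhds p, q ∈ Ω := hΩ.mem_nhds hp
  have ee := (alg p hp).2.1
  have eve : ∀ᶠ q in nhds p, e q = e p := by
    have : ∀ᶠ q in nhds p, 0 < e q * e p := by
      refine (de.mul continuousAt_const).eventually (lt_mem_nhds ?_)
      change 0 < e p * e p
      nlinarith
    filter_upwards [this, evΩ] with q h1 hq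
    have h2 := (alg q hq).2.1
    have : (e q * e p - 1) * (e q * e p + 1) = 0 := by
      linear_combination e p ^ 2 * h2 + ee
    rcases mul_eq_zero.1 this with h | h
    · linear_combination e p * h - e q * ee
    · linarith
  have evu : ∀ᶠ q in nhds p, HD u (A q.1 * c q * (At (u q))⁻¹)
      (-e p * B q.1 * s q * (At (u q))⁻¹) q := by
    filter_upwards [eve, evΩ] with q h1 hq
    obtain ⟨-, -, a, b, -, -⟩ := alg q hq
    exact (du q hq).congr_val a (h1 ▸ b)
  have evv : ∀ᶠ q in nhds p, HD v (A q.1 * s q * (Bt (u q))⁻¹)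
      (e p * B q.1 * c q * (Bt (u q))⁻¹) q := by
    filter_upwards [eve, evΩ] with q h1 hq
    obtain ⟨-, -, -, -, a, b⟩ := alg q hq
    exact (dv q hq).congr_val a (h1 ▸ b)
  have ev1 : ∀ᶠ q in nhds p, HD c (s q * (Pt (u q) * vx q))
      (-1 * s q * (e p * P q.1 - Pt (u q) * vy q)) q ∧
      HD s (-1 * c q * (Pt (u q) * vx q)) (c q * (e p * P q.1 - Pt (u q) * vy q)) q := by
    filter_upwards [eve, evΩ, evu.eventually_nhds, evv.eventually_nhds, evΩ.eventually_nhds]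
      with q h1 hq g1 g2 g3
    have := step1 (p := q) (c := c) (s := s) ee (hA q hq) (hB q hq) (hAt q hq) (hBt q hq) (pA q hq)
      (pB q hq) (pAt q hq) (pBt q hq)
      (g3.mono fun r hr => (alg r hr).1) g1 g2 (dc q hq) (ds q hq)
    obtain ⟨-, -, -, -, a, b⟩ := alg q hq
    rw [← a, ← h1, ← b] at this
    rw [← h1]
    simpa only [neg_one_mul] using this
  have fin := step2 (ux := ux) (uy := uy) (vx := vx) (vy := vy) (hP p hp) (hPt p hp) (alg p hp).1
    (du p hp) (evΩ.mono fun q hq => dv q hq)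
    (dvx p hp) (dvy p hp) (ev1.mono fun q h => h.1) (ev1.mono fun q h => h.2)
  have hdet : (ux p * vy p - uy p * vx p) * (At (u p) * Bt (u p)) = e p * (A p.1 * B p.1) := by
    have b1 := pA p hp
    have b2 := pB p hp
    simp only [he]
    field_simp
  have hne : e p ≠ 0 := by intro h; rw [h] at ee; norm_num at ee
  apply mul_left_cancel₀ hne
  linear_combination (At (u p) * Bt (u p)) * fin + Pt1 (u p) * hdet

noncomputable def WW (C x : ℝ) : ℝ := (-x ^ ((8:ℝ)/3) + 3 * C * x ^ 2 - 3) / (3 * x ^ 2)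
noncomputable def AA (C x : ℝ) : ℝ := (x ^ 2 * √(WW C x))⁻¹
noncomputable def PP (C x : ℝ) : ℝ := -√(WW C x)
noncomputable def PP1 (C x : ℝ) : ℝ := -(1 - x ^ ((8:ℝ)/3) / 9) * (AA C x * x⁻¹)

lemma geom {C x : ℝ} (hx : 0 < x) (hf : 0 < -x ^ ((8:ℝ)/3) + 3 * C * x ^ 2 - 3) :
    0 < AA C x ∧ 3 / (x ^ 2 * (-x ^ ((8:ℝ)/3) + 3 * C * x ^ 2 - 3)) = AA C x ^ 2 ∧
    HasDerivAt (AA C) (deriv (AA C) x) x ∧ HasDerivAt (fun x : ℝ => x⁻¹) (PP C x * AA C x) x ∧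
    HasDerivAt (PP C) (PP1 C x) x := by
  have hW : 0 < WW C x := by unfold WW; positivity
  have hsq : √(WW C x) ^ 2 = WW C x := Real.sq_sqrt hW.le
  have hs : 0 < √(WW C x) := Real.sqrt_pos.2 hW
  have ht : x ^ ((8:ℝ)/3) = x * x ^ ((5:ℝ)/3) := by
    rw [show (8:ℝ)/3 = 1 + 5/3 by norm_num, Real.rpow_add hx, Real.rpow_one]
  have dW : HasDerivAt (WW C) (2 / x ^ 3 - 2 / 9 * x ^ ((5:ℝ)/3) / x ^ 2) x := by
    have h1 := Real.hasDerivAt_rpow_const (x := x) (p := (8:ℝ)/3) (Or.inl hx.ne')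
    have h2 : HasDerivAt (fun x : ℝ => x ^ 2) (2 * x) x := by simpa using hasDerivAt_pow 2 x
    have h3 := ((h1.fun_neg.fun_add (h2.const_mul (3 * C))).sub_const 3).fun_div (h2.const_mul 3)
      (by positivity)
    refine h3.congr_deriv ?_
    rw [show (8:ℝ)/3 - 1 = 5/3 by norm_num, ht]
    field_simp
    ring
  have dS := dW.sqrt hW.ne'
  refine ⟨by unfold AA; positivity, ?_, ?_, ?_, ?_⟩
  · unfold AA
    rw [inv_pow, mul_pow, hsq, WW]
    field_simp
  · refine DifferentiableAt.hasDerivAt ?_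
    exact (((differentiableAt_id.fun_pow 2).fun_mul dS.differentiableAt).fun_inv (by simp; constructor <;> positivity))
  · refine (hasDerivAt_inv hx.ne').congr_deriv ?_
    unfold PP AA
    field_simp
  · refine dS.fun_neg.congr_deriv ?_
    unfold PP1 AA
    rw [ht]
    field_simp


/-- any isometry `Θ : (D_C, g_C) → (D_C̃, g_C̃)`, where
`g_C = 3/(ξ²(−ξ^{8/3}+3Cξ²−3)) dξ² + (1/ξ²) dθ²` on `D_C = (ξ₀₁(C), ξ₀₂(C)) × ℝ`,
forces `C = C̃` and `Θ(ξ,θ) = (ξ, ±θ + a₁)`.  An isometry is formalized as a bijection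
between the two domains whose pullback of `g_C̃` equals `g_C` (expressed through the
partial derivatives of `Θ`). -/
theorem gC_isometry_rigidity (C C' : ℝ)
    (hC : C > 4 / (3:ℝ) ^ ((3:ℝ)/2)) (hC' : C' > 4 / (3:ℝ) ^ ((3:ℝ)/2))
    (ξ₀₁ ξ₀₂ ξ'₀₁ ξ'₀₂ : ℝ)
    (h01 : 0 < ξ₀₁) (h12 : ξ₀₁ < ξ₀₂)
    (h01' : 0 < ξ'₀₁) (h12' : ξ'₀₁ < ξ'₀₂)
    (hz1 : -ξ₀₁ ^ ((8:ℝ)/3) + 3 * C * ξ₀₁ ^ 2 - 3 = 0)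
    (hz2 : -ξ₀₂ ^ ((8:ℝ)/3) + 3 * C * ξ₀₂ ^ 2 - 3 = 0)
    (hz1' : -ξ'₀₁ ^ ((8:ℝ)/3) + 3 * C' * ξ'₀₁ ^ 2 - 3 = 0)
    (hz2' : -ξ'₀₂ ^ ((8:ℝ)/3) + 3 * C' * ξ'₀₂ ^ 2 - 3 = 0)
    (hpos : ∀ ξ ∈ Ioo ξ₀₁ ξ₀₂, 0 < -ξ ^ ((8:ℝ)/3) + 3 * C * ξ ^ 2 - 3)
    (hpos' : ∀ ξ ∈ Ioo ξ'₀₁ ξ'₀₂, 0 < -ξ ^ ((8:ℝ)/3) + 3 * C' * ξ ^ 2 - 3)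
    -- the metric coefficients of `g_C` and of `g_{C'}`
    (E G E' G' : ℝ → ℝ)
    (hE : ∀ ξ, E ξ = 3 / (ξ ^ 2 * (-ξ ^ ((8:ℝ)/3) + 3 * C * ξ ^ 2 - 3)))
    (hG : ∀ ξ, G ξ = 1 / ξ ^ 2)
    (hE' : ∀ ξ, E' ξ = 3 / (ξ ^ 2 * (-ξ ^ ((8:ℝ)/3) + 3 * C' * ξ ^ 2 - 3)))
    (hG' : ∀ ξ, G' ξ = 1 / ξ ^ 2)
    -- the isometry `Θ` with components `Θ₁, Θ₂`
    (Θ₁ Θ₂ : ℝ × ℝ → ℝ)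
    (hsmooth : ContDiffOn ℝ 2 (fun p => (Θ₁ p, Θ₂ p)) (Ioo ξ₀₁ ξ₀₂ ×ˢ (univ : Set ℝ)))
    (hbij : BijOn (fun p => (Θ₁ p, Θ₂ p))
      (Ioo ξ₀₁ ξ₀₂ ×ˢ (univ : Set ℝ)) (Ioo ξ'₀₁ ξ'₀₂ ×ˢ (univ : Set ℝ)))
    -- pullback of `g_{C'}` by `Θ` equals `g_C`
    (hpb₁ : ∀ ξ ∈ Ioo ξ₀₁ ξ₀₂, ∀ θ : ℝ,
      E' (Θ₁ (ξ, θ)) * (deriv (fun x => Θ₁ (x, θ)) ξ) ^ 2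
        + G' (Θ₁ (ξ, θ)) * (deriv (fun x => Θ₂ (x, θ)) ξ) ^ 2 = E ξ)
    (hpb₂ : ∀ ξ ∈ Ioo ξ₀₁ ξ₀₂, ∀ θ : ℝ,
      E' (Θ₁ (ξ, θ)) * deriv (fun x => Θ₁ (x, θ)) ξ * deriv (fun y => Θ₁ (ξ, y)) θ
        + G' (Θ₁ (ξ, θ)) * deriv (fun x => Θ₂ (x, θ)) ξ * deriv (fun y => Θ₂ (ξ, y)) θ = 0)
    (hpb₃ : ∀ ξ ∈ Ioo ξ₀₁ ξ₀₂, ∀ θ : ℝ,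
      E' (Θ₁ (ξ, θ)) * (deriv (fun y => Θ₁ (ξ, y)) θ) ^ 2
        + G' (Θ₁ (ξ, θ)) * (deriv (fun y => Θ₂ (ξ, y)) θ) ^ 2 = G ξ) :
    C = C' ∧ ∃ ε a₁ : ℝ, (ε = 1 ∨ ε = -1) ∧
      ∀ ξ ∈ Ioo ξ₀₁ ξ₀₂, ∀ θ : ℝ, Θ₁ (ξ, θ) = ξ ∧ Θ₂ (ξ, θ) = ε * θ + a₁ := by
  set Ω : Set (ℝ × ℝ) := Ioo ξ₀₁ ξ₀₂ ×ˢ (univ : Set ℝ) with hΩdef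
  have hΩ : IsOpen Ω := isOpen_Ioo.prod isOpen_univ
  have hu : ContDiffOn ℝ 2 Θ₁ Ω := hsmooth.fst
  have hv : ContDiffOn ℝ 2 Θ₂ Ω := hsmooth.snd
  have hdiff : ∀ {w : ℝ × ℝ → ℝ}, ContDiffOn ℝ 2 w Ω → ∀ q ∈ Ω, DifferentiableAt ℝ w q :=
    fun hw q hq => (hw.differentiableOn (by norm_num)).differentiableAt (hΩ.mem_nhds hq)
  have hdx : ∀ {w : ℝ × ℝ → ℝ}, ContDiffOn ℝ 2 w Ω → ∀ q ∈ Ω,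
      deriv (fun x => w (x, q.2)) q.1 = fderiv ℝ w q (1, 0) := by
    intro w hw q hq
    have h := HasFDerivAt.comp_hasDerivAt (f := fun x : ℝ => (x, q.2)) q.1 (hdiff hw q hq).hasFDerivAt
      ((hasDerivAt_id q.1).prodMk (hasDerivAt_const q.1 q.2))
    exact h.deriv
  have hdy : ∀ {w : ℝ × ℝ → ℝ}, ContDiffOn ℝ 2 w Ω → ∀ q ∈ Ω,
      deriv (fun y => w (q.1, y)) q.2 = fderiv ℝ w q (0, 1) := by
    intro w hw q hq
    have h := HasFDerivAt.comp_hasDerivAt (f := fun y : ℝ => (q.1, y)) q.2 (hdiff hw q hq).hasFDerivAt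
      ((hasDerivAt_const q.2 q.1).prodMk (hasDerivAt_id q.2))
    exact h.deriv
  have hx : ∀ q ∈ Ω, 0 < q.1 := fun q hq => h01.trans hq.1.1
  have hmem : ∀ q ∈ Ω, Θ₁ q ∈ Ioo ξ'₀₁ ξ'₀₂ := fun q hq => (hbij.mapsTo hq).1
  have hut : ∀ q ∈ Ω, 0 < Θ₁ q := fun q hq => h01'.trans (hmem q hq).1
  have gS := fun q (hq : q ∈ Ω) => geom (hx q hq) (hpos q.1 hq.1)
  have gT := fun q (hq : q ∈ Ω) => geom (hut q hq) (hpos' _ (hmem q hq))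
  have m1 : ∀ q ∈ Ω, (AA C' (Θ₁ q) * fderiv ℝ Θ₁ q (1, 0)) ^ 2 +
      ((Θ₁ q)⁻¹ * fderiv ℝ Θ₂ q (1, 0)) ^ 2 = AA C q.1 ^ 2 := by
    intro q hq
    have := hpb₁ q.1 hq.1 q.2
    rw [hdx hu q hq, hdx hv q hq, hE, hE', hG', (gS q hq).2.1, (gT q hq).2.1] at this
    rw [← this]; ring
  have m2 : ∀ q ∈ Ω, (AA C' (Θ₁ q) * fderiv ℝ Θ₁ q (1, 0)) * (AA C' (Θ₁ q) * fderiv ℝ Θ₁ q (0, 1)) +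
      ((Θ₁ q)⁻¹ * fderiv ℝ Θ₂ q (1, 0)) * ((Θ₁ q)⁻¹ * fderiv ℝ Θ₂ q (0, 1)) = 0 := by
    intro q hq
    have := hpb₂ q.1 hq.1 q.2
    rw [hdx hu q hq, hdx hv q hq, hdy hu q hq, hdy hv q hq, hE', hG', (gT q hq).2.1] at this
    simp only [Prod.mk.eta] at this
    linear_combination this
  have m3 : ∀ q ∈ Ω, (AA C' (Θ₁ q) * fderiv ℝ Θ₁ q (0, 1)) ^ 2 +
      ((Θ₁ q)⁻¹ * fderiv ℝ Θ₂ q (0, 1)) ^ 2 = (q.1⁻¹) ^ 2 := by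
    intro q hq
    have := hpb₃ q.1 hq.1 q.2
    rw [hdy hu q hq, hdy hv q hq, hE', hG, hG', (gT q hq).2.1] at this
    simp only [Prod.mk.eta] at this
    linear_combination this
  have curv := egregium (A := AA C) (A1 := deriv (AA C)) (B := fun x => x⁻¹) (P := PP C) (P1 := PP1 C)
    (At := AA C') (At1 := deriv (AA C')) (Bt := fun x => x⁻¹) (Pt := PP C') (Pt1 := PP1 C')
    hΩ hu hv (fun q hq => (gS q hq).2.2.1) (fun q hq => (gS q hq).2.2.2.1)
    (fun q hq => (gS q hq).2.2.2.2) (fun q hq => (gT q hq).2.2.1) (fun q hq => (gT q hq).2.2.2.1)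
    (fun q hq => (gT q hq).2.2.2.2) (fun q hq => (gS q hq).1) (fun q hq => inv_pos.2 (hx q hq))
    (fun q hq => (gT q hq).1) (fun q hq => inv_pos.2 (hut q hq)) m1 m2 m3
  have hid : ∀ q ∈ Ω, Θ₁ q = q.1 := by
    intro q hq
    have h := curv q hq
    simp only [PP1] at h
    have b1 := (gS q hq).1
    have b2 := (gT q hq).1
    have b3 := hx q hq
    have b4 := hut q hq
    have hne : (AA C q.1 * q.1⁻¹) * (AA C' (Θ₁ q) * (Θ₁ q)⁻¹) ≠ 0 := by positivity
    have h' : q.1 ^ ((8:ℝ)/3) = Θ₁ q ^ ((8:ℝ)/3) := by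
      apply mul_left_cancel₀ hne
      linear_combination 9 * h
    exact ((Real.rpow_left_inj b3.le b4.le (by norm_num)).1 h').symm
  have hfu : ∀ q ∈ Ω, fderiv ℝ Θ₁ q (1, 0) = 1 ∧ fderiv ℝ Θ₁ q (0, 1) = 0 := by
    intro q hq
    exact HD.unique (HD.of_diff (hdiff hu q hq))
      ((HD.fst q).congr_ev (Filter.mem_of_superset (hΩ.mem_nhds hq) hid))
  have hfy : ∀ q ∈ Ω, fderiv ℝ Θ₂ q (0, 1) ^ 2 = 1 := by
    intro q hq
    have h := m3 q hq
    have b := hx q hq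
    rw [(hfu q hq).2, hid q hq] at h
    field_simp at h
    linarith
  have hfx : ∀ q ∈ Ω, fderiv ℝ Θ₂ q (1, 0) = 0 := by
    intro q hq
    have h := m2 q hq
    have b := hx q hq
    have h' := hfy q hq
    rw [(hfu q hq).2, hid q hq] at h
    field_simp at h
    have h0 : fderiv ℝ Θ₂ q (0, 1) ≠ 0 := by intro h0; rw [h0] at h'; norm_num at h'
    simpa [h0] using h
  refine ⟨?_, ?_⟩
  · obtain ⟨x, hxm⟩ := nonempty_Ioo.2 h12
    have hq : (x, (0:ℝ)) ∈ Ω := ⟨hxm, trivial⟩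
    have h := m1 _ hq
    have g1 := (gS _ hq).2.1
    have g2 := (gT _ hq).2.1
    have f1 := hpos _ hxm
    have f2 := hpos' _ (hmem _ hq)
    have b := hx _ hq
    rw [hfx _ hq, (hfu _ hq).1, mul_one, mul_zero, ← g1, ← g2] at h
    rw [hid _ hq] at h f2
    simp only at h f2 b
    rw [zero_pow two_ne_zero, add_zero, div_eq_div_iff (by positivity) (by positivity)] at h
    have : 9 * x ^ 4 * (C - C') = 0 := by linear_combination h
    have h3 : C - C' = 0 := by
      rcases mul_eq_zero.1 this with h | h
      · exact absurd h (by positivity)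
      · exact h
    linarith
  · have hconn : IsPreconnected Ω := isPreconnected_Ioo.prod isPreconnected_univ
    have hcont : ContinuousOn (fun q => fderiv ℝ Θ₂ q (0, 1)) Ω :=
      (hv.continuousOn_fderiv_of_isOpen hΩ (by norm_num)).clm_apply continuousOn_const
    have hsgn : ∃ ε : ℝ, (ε = 1 ∨ ε = -1) ∧ ∀ q ∈ Ω, fderiv ℝ Θ₂ q (0, 1) = ε := by
      rcases hconn.eq_one_or_eq_neg_one_of_sq_eq hcont (fun q hq => hfy q hq) with h | h
      · exact ⟨1, Or.inl rfl, fun q hq => h hq⟩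
      · exact ⟨-1, Or.inr rfl, fun q hq => h hq⟩
    obtain ⟨ε, hε, hεv⟩ := hsgn
    obtain ⟨x, hxm⟩ := nonempty_Ioo.2 h12
    have hq0 : (x, (0:ℝ)) ∈ Ω := ⟨hxm, trivial⟩
    have hD : ∀ q ∈ Ω, HasFDerivAt (fun q : ℝ × ℝ => Θ₂ q - ε * q.2) (0 : ℝ × ℝ →L[ℝ] ℝ) q := by
      intro q hq
      have h1 : HasFDerivAt Θ₂ _ q := HD.of_diff (hdiff hv q hq)
      rw [hfx q hq, hεv q hq] at h1
      refine (h1.fun_sub ((hasFDerivAt_snd (𝕜 := ℝ) (p := q)).const_mul ε)).congr_fderiv ?_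
      simp
    refine ⟨ε, Θ₂ (x, 0), hε, fun ξ hξ θ => ?_⟩
    have hq : (ξ, θ) ∈ Ω := ⟨hξ, trivial⟩
    refine ⟨hid _ hq, ?_⟩
    have := hΩ.is_const_of_fderiv_eq_zero hconn
      (fun q hq => (hD q hq).differentiableAt.differentiableWithinAt)
      (fun q hq => (hD q hq).fderiv) hq hq0
    simp only at this
    linarith
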